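/- arXiv:1504.03891 — 2 statements merged into one kernel-verified Lean document; each statement's English description precedes it below -/
import Mathlib

section
/- Let Ω ⊂ ℝ^d be bounded open, T > 0, Q_T = Ω × (0,T), and 0 = t₀ < … < t_n = T with Δt_{n,k} = t_k − t_{k−1}. Let π_m : ℝ^m → L^∞(Ω) and ∇_m : ℝ^m → L^∞(Ω; ℝ^d) be linear maps, ω_m ∈ L^∞(Ω), and P_m : C_c^∞(Ω) → ℝ^m linear with ∫_Ω ω_m π_m(u)(π_m(P_m φ) − φ) dx = 0 for all u ∈ ℝ^m, φ ∈ C_c^∞(Ω), and ‖∇_m P_m φ‖_{L^∞} ≤ C_P ‖∇φ‖_{L^∞} for all φ ∈ C_c^∞(Ω). Let A_n ∈ M_n(ℝ) be lower triangular invertible with ‖A_n^{−1}‖₁ ≤ C_A, Â_n the block-diagonal matrix with blocks 1 and A_n, and define the multistep derivative δ̂_m^n u = π_m^n( T_n^{−1} Â_n T_n M_n u ) for u ∈ (ℝ^m)^{n+1}. Suppose u ∈ (ℝ^m)^{n+1} satisfies ∫∫_{Q_T} ω_m · δ̂_m^n u · π_m^n ψ dx dt ≤ C₀ ‖∇_m^n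 ψ‖_{L^∞(Q_T)} for every ψ ∈ (ℝ^m)^{n+1}. Then for every φ ∈ C_c^∞(Ω × (0,T)): ∫∫_{Q_T} ω_m · π_m^n u · ∂_t φ dx dt ≤ C₀ C_A C_P ‖∇φ‖_{L^∞(Q_T)}. -/
open MeasureTheory Set

/-- A smooth compactly supported test function with support inside `U`. -/
def IsTestFun {E : Type*} [NormedAddCommGroup E] [NormedSpace ℝ E]
    (U : Set E) (φ : E → ℝ) : Prop :=
  ContDiff ℝ (⊤ : ℕ∞) φ ∧ HasCompactSupport φ ∧ tsupport φ ⊆ U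

/-- The lower bidiagonal difference matrix `D_n ∈ M_{n+1}(ℝ)` with `1` on the diagonal
and `−1` on the subdiagonal. -/
def Dmat (n : ℕ) : Matrix (Fin (n+1)) (Fin (n+1)) ℝ :=
  Matrix.of fun i j => if i = j then 1 else if i.1 = j.1 + 1 then -1 else 0

/-- The diagonal matrix `T_n = diag(1, Δt₁, …, Δt_n) ∈ M_{n+1}(ℝ)`. -/
def Tmat (n : ℕ) (Δt : Fin n → ℝ) : Matrix (Fin (n+1)) (Fin (n+1)) ℝ :=
  Matrix.diagonal (Fin.cons 1 Δt)

/-- The block-diagonal matrix `Â_n = blockdiag(1, A) ∈ M_{n+1}(ℝ)`. -/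
def lowerBlock (n : ℕ) (A : Matrix (Fin n) (Fin n) ℝ) :
    Matrix (Fin (n+1)) (Fin (n+1)) ℝ :=
  Matrix.of (Fin.cons (Fin.cons 1 0) (fun i => Fin.cons 0 (A i)))

lemma Dmat_mul_succ {n m : ℕ} (u : Matrix (Fin (n+1)) (Fin m) ℝ) (k : Fin n) :
    (Dmat n * u) k.succ = u k.succ - u k.castSucc := by
  ext c
  have h (j : Fin (n+1)) : Dmat n k.succ j * u j c =
      (if j = k.succ then u j c else 0) - (if j = k.castSucc then u j c else 0) := by
    by_cases h1 : j = k.succ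
    · subst h1
      simp [Dmat, Fin.ext_iff]
    · by_cases h2 : j = k.castSucc
      · subst h2
        simp [Dmat, Fin.ext_iff]
      · have h3 : ¬ (k.1 = j.1) := fun h => h2 (Fin.ext h.symm)
        simp [Dmat, h1, h2, h3, Ne.symm h1]
  simp [Matrix.mul_apply, h, Finset.sum_sub_distrib]

lemma lowerBlock_mul_succ {n m : ℕ} (A : Matrix (Fin n) (Fin n) ℝ)
    (v : Matrix (Fin (n+1)) (Fin m) ℝ) (k : Fin n) :
    (lowerBlock n A * v) k.succ = ∑ j, A k j • v j.succ := by
  ext c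
  simp [Matrix.mul_apply, lowerBlock, Fin.sum_univ_succ, Finset.sum_apply]

/-- The rows of the multistep derivative, scaled by the time step. -/
lemma smul_multistep_row {n m : ℕ} (Δt : Fin n → ℝ) (hΔt : ∀ k, Δt k ≠ 0)
    (A : Matrix (Fin n) (Fin n) ℝ) (u : Matrix (Fin (n+1)) (Fin m) ℝ) (k : Fin n) :
    Δt k • ((Tmat n Δt)⁻¹ * lowerBlock n A * Tmat n Δt * ((Tmat n Δt)⁻¹ * Dmat n) * u) k.succ =
      ∑ j, A k j • (u j.succ - u j.castSucc) := by
  have hdet : IsUnit (Tmat n Δt).det := by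
    rw [Tmat, Matrix.det_diagonal, isUnit_iff_ne_zero, Finset.prod_ne_zero_iff]
    intro i _
    cases i using Fin.cases with
    | zero => simp
    | succ i => simpa using hΔt i
  have hmul : Tmat n Δt *
      ((Tmat n Δt)⁻¹ * lowerBlock n A * Tmat n Δt * ((Tmat n Δt)⁻¹ * Dmat n) * u) =
      lowerBlock n A * (Dmat n * u) := by
    simp only [Matrix.mul_assoc]
    rw [Matrix.mul_nonsing_inv_cancel_left _ _ hdet, Matrix.mul_nonsing_inv_cancel_left _ _ hdet]
  have hrow := congrFun hmul k.succ
  rw [lowerBlock_mul_succ] at hrow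
  simp only [Dmat_mul_succ] at hrow
  rw [← hrow]
  ext c
  simp [Tmat, Matrix.diagonal_mul]

lemma sum_mul_sub_eq_neg_sum_sub_mul {V : Type*} [AddCommGroup V] [Module ℝ V] {n : ℕ}
    (B : V →ₗ[ℝ] V →ₗ[ℝ] ℝ) (u p : Fin (n+1) → V) (h0 : p 0 = 0) (hn : p (Fin.last n) = 0) :
    ∑ k : Fin n, B (u k.succ) (p k.succ - p k.castSucc) =
      -∑ k : Fin n, B (u k.succ - u k.castSucc) (p k.castSucc) := by
  have h1 := Fin.sum_univ_succ (fun k => B (u k) (p k))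
  have h2 := Fin.sum_univ_castSucc (fun k => B (u k) (p k))
  simp only [h0, hn, map_zero] at h1 h2
  simp only [map_sub, LinearMap.sub_apply, Finset.sum_sub_distrib]
  linarith

lemma sum_bilin_inv_transpose {V : Type*} [AddCommGroup V] [Module ℝ V] {n : ℕ}
    (B : V →ₗ[ℝ] V →ₗ[ℝ] ℝ) (A : Matrix (Fin n) (Fin n) ℝ) (hA : IsUnit A.det)
    (v p : Fin n → V) :
    ∑ k, B (∑ j, A k j • v j) (∑ i, A⁻¹ i k • p i) = ∑ j, B (v j) (p j) := by
  have hinv (i j : Fin n) : ∑ k, A⁻¹ i k * A k j = if i = j then 1 else 0 := by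
    rw [← Matrix.mul_apply, Matrix.nonsing_inv_mul _ hA, Matrix.one_apply]
  calc ∑ k, B (∑ j, A k j • v j) (∑ i, A⁻¹ i k • p i)
      = ∑ k, ∑ i, ∑ j, A⁻¹ i k * A k j * B (v j) (p i) := by
        simp [map_sum, LinearMap.sum_apply, Finset.mul_sum, mul_assoc]
    _ = ∑ i, ∑ j, ∑ k, A⁻¹ i k * A k j * B (v j) (p i) := by
        rw [Finset.sum_comm]
        exact Finset.sum_congr rfl fun i _ => Finset.sum_comm
    _ = ∑ j, B (v j) (p j) := by
        simp [← Finset.sum_mul, hinv]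

lemma tsupport_slice_subset {X : Type*} [TopologicalSpace X] (φ : X × ℝ → ℝ) (s : ℝ) :
    tsupport (fun y => φ (y, s)) ⊆ (fun y => (y, s)) ⁻¹' tsupport φ :=
  tsupport_comp_subset_preimage φ (by fun_prop)

lemma slice_eq_zero {X : Type*} [TopologicalSpace X] {Ω : Set X} {I : Set ℝ} {φ : X × ℝ → ℝ}
    (hφ : tsupport φ ⊆ Ω ×ˢ I) {s : ℝ} (hs : s ∉ I) : (fun y => φ (y, s)) = 0 := by
  funext y
  by_contra h
  exact hs (hφ (subset_tsupport φ h)).2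

lemma IsTestFun.slice {E : Type*} [NormedAddCommGroup E] [NormedSpace ℝ E] {Ω : Set E}
    {I : Set ℝ} {φ : E × ℝ → ℝ} (hφ : IsTestFun (Ω ×ˢ I) φ) (s : ℝ) :
    IsTestFun Ω (fun y => φ (y, s)) := by
  obtain ⟨hsm, hc, hsupp⟩ := hφ
  refine ⟨hsm.comp (by fun_prop), ?_, fun y hy => (hsupp (tsupport_slice_subset φ s hy)).1⟩
  exact (hc.isCompact.image continuous_fst).of_isClosed_subset (isClosed_tsupport _)
    fun y hy => ⟨(y, s), tsupport_slice_subset φ s hy, rfl⟩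

lemma IsTestFun.exists_bound {E : Type*} [NormedAddCommGroup E] [NormedSpace ℝ E] {Ω : Set E}
    {g : E → ℝ} (hg : IsTestFun Ω g) : ∃ M, ∀ x, |g x| ≤ M :=
  hg.2.1.exists_bound_of_continuous hg.1.continuous

/-- Gradient bounds on the space-time domain pass to all time slices on the whole space. -/
lemma IsTestFun.norm_fderiv_slice_le {E : Type*} [NormedAddCommGroup E] [NormedSpace ℝ E]
    {Ω : Set E} {I : Set ℝ} {φ : E × ℝ → ℝ} (hφ : IsTestFun (Ω ×ˢ I) φ) {M : ℝ} (hM : 0 ≤ M)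
    (h : ∀ x ∈ Ω, ∀ s ∈ I, ‖fderiv ℝ (fun y => φ (y, s)) x‖ ≤ M) (s : ℝ) (x : E) :
    ‖fderiv ℝ (fun y => φ (y, s)) x‖ ≤ M := by
  by_cases hs : s ∈ I
  · by_cases hx : x ∈ Ω
    · exact h x hx s hs
    · have : x ∉ tsupport (fun y => φ (y, s)) := fun h' => hx ((hφ.slice s).2.2 h')
      rw [fderiv_of_notMem_tsupport ℝ this]
      simpa using hM
  · rw [slice_eq_zero hφ.2.2 hs]
    simpa using hM

lemma integrable_of_measurable_of_bounded {X : Type*} [MeasurableSpace X] {μ : Measure X}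
    [IsFiniteMeasure μ] {f : X → ℝ} (hf : Measurable f) (hb : ∃ M, ∀ x, |f x| ≤ M) :
    Integrable f μ := by
  obtain ⟨M, hM⟩ := hb
  exact Integrable.of_bound hf.aestronglyMeasurable M (.of_forall hM)

lemma exists_bound_mul {X : Type*} {f g : X → ℝ} (hf : ∃ M, ∀ x, |f x| ≤ M)
    (hg : ∃ M, ∀ x, |g x| ≤ M) : ∃ M, ∀ x, |f x * g x| ≤ M := by
  obtain ⟨M, hM⟩ := hf
  obtain ⟨N, hN⟩ := hg
  refine ⟨M * N, fun x => ?_⟩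
  rw [abs_mul]
  exact mul_le_mul (hM x) (hN x) (abs_nonneg _) ((abs_nonneg _).trans (hM x))

/-- Fubini and the fundamental theorem of calculus on a time slab. -/
lemma integral_Ioc_integral_mul_deriv {d : ℕ} {μ : Measure (Fin d → ℝ)} [IsFiniteMeasure μ]
    {f : (Fin d → ℝ) → ℝ} (hf : Measurable f) (hfb : ∃ M, ∀ x, |f x| ≤ M)
    {U : Set ((Fin d → ℝ) × ℝ)} {φ : (Fin d → ℝ) × ℝ → ℝ} (hφ : IsTestFun U φ)
    {a b : ℝ} (hab : a ≤ b) :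
    ∫ s in Ioc a b, ∫ x, f x * deriv (fun r => φ (x, r)) s ∂μ =
      ∫ x, f x * (φ (x, b) - φ (x, a)) ∂μ := by
  have hder (x : Fin d → ℝ) (s : ℝ) :
      HasDerivAt (fun r => φ (x, r)) (fderiv ℝ φ (x, s) (0, 1)) s := by
    have h1 : HasFDerivAt φ (fderiv ℝ φ (x, s)) (x, s) :=
      (hφ.1.differentiable (by simp) _).hasFDerivAt
    exact h1.comp_hasDerivAt s ((hasDerivAt_const s x).prodMk (hasDerivAt_id s))
  have hcont : Continuous (fun z : (Fin d → ℝ) × ℝ => fderiv ℝ φ z (0, 1)) :=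
    (hφ.1.continuous_fderiv (by simp)).clm_apply continuous_const
  have hbound : ∃ M, ∀ z, |fderiv ℝ φ z (0, 1)| ≤ M :=
    (hφ.2.1.fderiv_apply (𝕜 := ℝ) (0, 1)).exists_bound_of_continuous hcont
  simp only [fun x s => (hder x s).deriv]
  have hint : Integrable (fun z : ℝ × (Fin d → ℝ) => f z.2 * fderiv ℝ φ (z.2, z.1) (0, 1))
      ((volume.restrict (Ioc a b)).prod μ) := by
    refine integrable_of_measurable_of_bounded
      ((hf.comp measurable_snd).mul (hcont.measurable.comp measurable_swap))
      (exists_bound_mul ?_ ?_)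
    · exact hfb.imp fun M hM z => hM z.2
    · exact hbound.imp fun M hM z => hM (z.2, z.1)
  rw [integral_integral_swap hint]
  congr 1 with x
  rw [integral_const_mul, ← intervalIntegral.integral_of_le hab,
    intervalIntegral.integral_eq_sub_of_hasDerivAt fun s _ => hder x s]
  exact (hcont.comp (by fun_prop : Continuous fun s : ℝ => (x, s))).intervalIntegrable _ _

/-- The weighted `L²` pairing of reconstructions, as a bilinear form. -/
noncomputable def weightedForm {X V : Type*} [MeasurableSpace X] [AddCommGroup V] [Module ℝ V]
    (μ : Measure X) [IsFiniteMeasure μ] (ω : X → ℝ) (π : V →ₗ[ℝ] (X → ℝ))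
    (hω : Measurable ω) (hωb : ∃ M, ∀ x, |ω x| ≤ M) (hπ : ∀ w, Measurable (π w))
    (hπb : ∀ w, ∃ M, ∀ x, |π w x| ≤ M) : V →ₗ[ℝ] V →ₗ[ℝ] ℝ :=
  have hint (w v : V) : Integrable (fun x => ω x * π w x * π v x) μ :=
    integrable_of_measurable_of_bounded ((hω.mul (hπ w)).mul (hπ v))
      (exists_bound_mul (exists_bound_mul hωb (hπb w)) (hπb v))
  LinearMap.mk₂ ℝ (fun w v => ∫ x, ω x * π w x * π v x ∂μ)
    (fun w w' v => by
      rw [← integral_add (hint w v) (hint w' v)]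
      congr 1 with x
      simp only [map_add, Pi.add_apply]
      ring)
    (fun c w v => by
      rw [smul_eq_mul, ← integral_const_mul]
      congr 1 with x
      simp only [map_smul, Pi.smul_apply, smul_eq_mul]
      ring)
    (fun w v v' => by
      rw [← integral_add (hint w v) (hint w v')]
      congr 1 with x
      simp only [map_add, Pi.add_apply]
      ring)
    (fun c w v => by
      rw [smul_eq_mul, ← integral_const_mul]
      congr 1 with x
      simp only [map_smul, Pi.smul_apply, smul_eq_mul]
      ring)

/-- Reduction of a multistep weak time-derivative estimate to a semi-discrete one:
if the discrete unknown `u` satisfies the weighted dual estimate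
`∫∫ ω δ̂_m^n u · π_m^n ψ ≤ C₀ ‖∇_m^n ψ‖_∞` for all discrete test vectors `ψ`, where
`δ̂_m^n u = π_m^n(T_n⁻¹ Â_n T_n M_n u)` is a multistep differentiation operator with
`‖A_n⁻¹‖₁ ≤ C_A`, then
`∫∫ ω π_m^n u ∂_t φ ≤ C₀ C_A C_P ‖∇φ‖_∞` for every `φ ∈ C_c^∞(Ω × (0,T))`.
Piecewise-constant-in-time reconstructions are unfolded as sums over time slabs. -/
theorem multistep_to_semidiscrete_estimate
    (d m n : ℕ) (hn : 0 < n)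
    (Ω : Set (Fin d → ℝ)) (hΩo : IsOpen Ω) (hΩb : Bornology.IsBounded Ω)
    (T : ℝ) (hT : 0 < T)
    (t : Fin (n+1) → ℝ) (ht0 : t 0 = 0) (htT : t (Fin.last n) = T) (htmono : StrictMono t)
    (πm : (Fin m → ℝ) →ₗ[ℝ] ((Fin d → ℝ) → ℝ))
    (hπmeas : ∀ w : Fin m → ℝ, Measurable (πm w))
    (hπbdd : ∀ w : Fin m → ℝ, ∃ M : ℝ, ∀ x, |πm w x| ≤ M)
    (Gm : (Fin m → ℝ) →ₗ[ℝ] ((Fin d → ℝ) → (Fin d → ℝ)))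
    (ωm : (Fin d → ℝ) → ℝ) (hωmeas : Measurable ωm) (hωbdd : ∃ M : ℝ, ∀ x, |ωm x| ≤ M)
    (CP : ℝ)
    (Pm : ((Fin d → ℝ) → ℝ) →ₗ[ℝ] (Fin m → ℝ))
    (hproj : ∀ (w : Fin m → ℝ) (g : (Fin d → ℝ) → ℝ), IsTestFun Ω g →
      ∫ x in Ω, ωm x * πm w x * (πm (Pm g) x - g x) = 0)
    (hPgrad : ∀ g : (Fin d → ℝ) → ℝ, IsTestFun Ω g → ∀ M : ℝ,
      (∀ x, ‖fderiv ℝ g x‖ ≤ M) → ∀ x ∈ Ω, ‖Gm (Pm g) x‖ ≤ CP * M)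
    (CA : ℝ)
    (A : Matrix (Fin n) (Fin n) ℝ)
    (hAlow : ∀ i j : Fin n, (i : ℕ) < (j : ℕ) → A i j = 0)
    (hAinv : IsUnit A.det)
    (hAnorm : ∀ j : Fin n, ∑ i : Fin n, |A⁻¹ i j| ≤ CA)
    (C₀ : ℝ)
    (u : Matrix (Fin (n+1)) (Fin m) ℝ)
    (hdual : ∀ ψ : Matrix (Fin (n+1)) (Fin m) ℝ, ∀ Mg : ℝ,
      (∀ k : Fin n, ∀ x ∈ Ω, ‖Gm (ψ k.succ) x‖ ≤ Mg) →
      ∑ k : Fin n, (t k.succ - t k.castSucc) *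
          ∫ x in Ω, ωm x *
            πm (((Tmat n (fun k => t k.succ - t k.castSucc))⁻¹ * lowerBlock n A *
                  Tmat n (fun k => t k.succ - t k.castSucc) *
                  ((Tmat n (fun k => t k.succ - t k.castSucc))⁻¹ * Dmat n) * u) k.succ) x *
            πm (ψ k.succ) x
        ≤ C₀ * Mg) :
    ∀ φ : (Fin d → ℝ) × ℝ → ℝ, IsTestFun (Ω ×ˢ Ioo 0 T) φ → ∀ Mφ : ℝ,
      (∀ x ∈ Ω, ∀ s ∈ Ioo (0:ℝ) T, ‖fderiv ℝ (fun y => φ (y, s)) x‖ ≤ Mφ) →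
      ∑ k : Fin n, ∫ s in Ioc (t k.castSucc) (t k.succ), ∫ x in Ω,
          ωm x * πm (u k.succ) x * deriv (fun r => φ (x, r)) s
        ≤ C₀ * CA * CP * Mφ := by
  intro φ hφ Mφ hMφ
  have : IsFiniteMeasure (volume.restrict Ω) :=
    isFiniteMeasure_restrict.2 hΩb.measure_lt_top.ne
  let B := weightedForm (volume.restrict Ω) ωm πm hωmeas hωbdd hπmeas hπbdd
  have hB (w v : Fin m → ℝ) : B w v = ∫ x in Ω, ωm x * πm w x * πm v x := rfl
  have hBP (w : Fin m → ℝ) (g : (Fin d → ℝ) → ℝ) (hg : IsTestFun Ω g) :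
      ∫ x in Ω, ωm x * πm w x * g x = B w (Pm g) := by
    have hωπ : Measurable fun x => ωm x * πm w x := hωmeas.mul (hπmeas w)
    have hωπb := exists_bound_mul hωbdd (hπbdd w)
    have h := hproj w g hg
    simp only [mul_sub] at h
    have hint (f : (Fin d → ℝ) → ℝ) (hf : Measurable f) (hfb : ∃ M, ∀ x, |f x| ≤ M) :
        Integrable (fun x => ωm x * πm w x * f x) (volume.restrict Ω) :=
      integrable_of_measurable_of_bounded (hωπ.mul hf) (exists_bound_mul hωπb hfb)
    rw [integral_sub (hint _ (hπmeas _) (hπbdd _))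
      (hint _ hg.1.continuous.measurable hg.exists_bound)] at h
    rw [hB]
    linarith
  let p (k : Fin (n+1)) : Fin m → ℝ := Pm fun y => φ (y, t k)
  have hp0 : p 0 = 0 := by
    simp only [p, ht0, slice_eq_zero hφ.2.2 (s := 0) (by simp), map_zero]
  have hpn : p (Fin.last n) = 0 := by
    simp only [p, htT, slice_eq_zero hφ.2.2 (s := T) (by simp), map_zero]
  have hslab (k : Fin n) : ∫ s in Ioc (t k.castSucc) (t k.succ), ∫ x in Ω,
      ωm x * πm (u k.succ) x * deriv (fun r => φ (x, r)) s =
      B (u k.succ) (p k.succ - p k.castSucc) := by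
    rw [integral_Ioc_integral_mul_deriv (f := fun x => ωm x * πm (u k.succ) x)
      (hωmeas.mul (hπmeas _)) (exists_bound_mul hωbdd (hπbdd _)) hφ
      (htmono k.castSucc_lt_succ).le]
    have hint (s : ℝ) : Integrable (fun x => ωm x * πm (u k.succ) x * φ (x, s))
        (volume.restrict Ω) :=
      integrable_of_measurable_of_bounded
        ((hωmeas.mul (hπmeas _)).mul (hφ.slice s).1.continuous.measurable)
        (exists_bound_mul (exists_bound_mul hωbdd (hπbdd _)) (hφ.slice s).exists_bound)
    simp only [mul_sub]
    rw [integral_sub (hint _) (hint _), hBP _ _ (hφ.slice _), hBP _ _ (hφ.slice _), map_sub]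
  let ψ : Matrix (Fin (n+1)) (Fin m) ℝ :=
    Fin.cons 0 fun k => -∑ i, A⁻¹ i k • p i.castSucc
  have hψ (k : Fin n) : ψ k.succ = -∑ i, A⁻¹ i k • p i.castSucc := rfl
  have hψbound (k : Fin n) (x : Fin d → ℝ) (hx : x ∈ Ω) :
      ‖Gm (ψ k.succ) x‖ ≤ CA * (CP * Mφ) := by
    have hM : 0 ≤ Mφ :=
      (norm_nonneg _).trans (hMφ x hx (T / 2) ⟨by linarith, by linarith⟩)
    have hG (j : Fin (n+1)) : ‖Gm (p j) x‖ ≤ CP * Mφ :=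
      hPgrad _ (hφ.slice _) Mφ (hφ.norm_fderiv_slice_le hM hMφ _) x hx
    have hCM : 0 ≤ CP * Mφ := (norm_nonneg _).trans (hG 0)
    calc ‖Gm (ψ k.succ) x‖ = ‖∑ i, A⁻¹ i k • Gm (p i.castSucc) x‖ := by
          rw [hψ]
          simp [map_sum, Finset.sum_apply]
      _ ≤ ∑ i, |A⁻¹ i k| * (CP * Mφ) := by
          refine norm_sum_le_of_le _ fun i _ => ?_
          rw [norm_smul, Real.norm_eq_abs]
          exact mul_le_mul_of_nonneg_left (hG _) (abs_nonneg _)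
      _ ≤ CA * (CP * Mφ) := by
          rw [← Finset.sum_mul]
          exact mul_le_mul_of_nonneg_right (hAnorm k) hCM
  have hmain := hdual ψ _ hψbound
  have hΔt (k : Fin n) : t k.succ - t k.castSucc ≠ 0 :=
    (sub_pos.2 (htmono k.castSucc_lt_succ)).ne'
  have hrow (w : Fin m → ℝ) (k : Fin n)
      (hw : (t k.succ - t k.castSucc) • w = ∑ j, A k j • (u j.succ - u j.castSucc)) :
      (t k.succ - t k.castSucc) * ∫ x in Ω, ωm x * πm w x * πm (ψ k.succ) x =
        -B (∑ j, A k j • (u j.succ - u j.castSucc)) (∑ i, A⁻¹ i k • p i.castSucc) := by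
    rw [← hB, ← smul_eq_mul, ← LinearMap.smul_apply, ← map_smul, hw, hψ, map_neg]
  rw [Finset.sum_congr rfl fun k _ => hrow _ k (smul_multistep_row _ hΔt A u k),
    Finset.sum_neg_distrib,
    sum_bilin_inv_transpose B A hAinv (fun j => u j.succ - u j.castSucc)
      fun i => p i.castSucc] at hmain
  rw [Finset.sum_congr rfl fun k _ => hslab k, sum_mul_sub_eq_neg_sum_sub_mul B u p hp0 hpn]
  calc _ ≤ _ := hmain
    _ = _ := by ring
end

section
/- Let 𝒯 be a finite nonempty set with cell measures m_K > 0 (K ∈ 𝒯), a symmetric neighbour relation (L ∈ N_K ⟺ K ∈ N_L, K ∉ N_K) and transmissibilities τ_{KL} = τ_{LK} ≥ 0 for L ∈ N_K. Let q > 1, ψ(u) = |u|^{q−1}u, φ(u) = (2√q/(q+1))|u|^{(q−1)/2}u, and Δt > 0. Suppose u⁰, u¹ ∈ ℝ^𝒯 satisfy the implicit Euler step: for all K ∈ 𝒯, (u_K¹ − u_K⁰) m_K/Δt + Σ_{L∈N_K} τ_{KL}(ψ(u_K¹) − ψ(u_L¹)) = 0. Then (1/2) Σ_{K∈𝒯}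 m_K (u_K¹)² + Δt Σ_{edges {K,L}} τ_{KL} (φ(u_K¹) − φ(u_L¹))² ≤ (1/2) Σ_{K∈𝒯} m_K (u_K⁰)². -/
/-- `ψ(u) = |u|^{q−1} u`. -/
noncomputable def psiPM (q u : ℝ) : ℝ := |u| ^ (q - 1) * u

/-- The Kirchhoff-type transform `φ(u) = (2√q/(q+1)) |u|^{(q−1)/2} u`. -/
noncomputable def phiPM (q u : ℝ) : ℝ := (2 * Real.sqrt q / (q + 1)) * (|u| ^ ((q - 1) / 2) * u)

theorem hasDerivAt_abs_rpow_mul_self {p : ℝ} (hp : 0 < p) (x : ℝ) :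
    HasDerivAt (fun u : ℝ => |u| ^ p * u) ((p + 1) * |x| ^ p) x := by
  rcases eq_or_ne x 0 with rfl | hx
  · have h0 : (p + 1) * |(0 : ℝ)| ^ p = 0 := by simp [Real.zero_rpow hp.ne']
    rw [h0, hasDerivAt_iff_tendsto_slope]
    have hc : Continuous fun u : ℝ => |u| ^ p := continuous_abs.rpow_const fun _ => Or.inr hp.le
    have ht : Filter.Tendsto (fun u : ℝ => |u| ^ p) (nhdsWithin 0 {0}ᶜ) (nhds 0) := by
      simpa [Real.zero_rpow hp.ne'] using (hc.tendsto 0).mono_left nhdsWithin_le_nhds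
    refine ht.congr' ?_
    filter_upwards [self_mem_nhdsWithin] with u hu
    have hu' : u ≠ 0 := hu
    simp only [slope_def_field, mul_zero, sub_zero]
    field_simp
  · have h := ((hasDerivAt_abs hx).rpow_const (p := p) (Or.inl (abs_ne_zero.mpr hx))).mul
      (hasDerivAt_id x)
    refine h.congr_deriv ?_
    have h1 : |x| ^ (p - 1) * |x| = |x| ^ p := by
      rw [← Real.rpow_add_one (abs_ne_zero.mpr hx)]
      congr 1
      ring
    have h2 : (SignType.sign x : ℝ) * x = |x| := sign_mul_self x
    simp only [id]
    linear_combination p * |x| ^ (p - 1) * h2 + p * h1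

/-- For every `t`, the function `ψ - 2 t φ + t² id` is nondecreasing, since its derivative is
`(φ' - t)²`. -/
theorem monotone_psiPM_sub_phiPM_add {q : ℝ} (hq : 1 < q) (t : ℝ) :
    Monotone fun u : ℝ => psiPM q u - 2 * t * phiPM q u + t ^ 2 * u := by
  refine monotone_of_hasDerivAt_nonneg
    (f' := fun x => (Real.sqrt q * |x| ^ ((q - 1) / 2) - t) ^ 2) (fun x => ?_)
    (fun x => sq_nonneg _)
  have hψ := hasDerivAt_abs_rpow_mul_self (sub_pos.mpr hq) x
  have hφ := (hasDerivAt_abs_rpow_mul_self (half_pos (sub_pos.mpr hq)) x).const_mul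
    (2 * Real.sqrt q / (q + 1))
  refine ((hψ.sub (hφ.const_mul (2 * t))).add ((hasDerivAt_id x).const_mul (t ^ 2))).congr_deriv ?_
  have h1 : |x| ^ (q - 1) = (|x| ^ ((q - 1) / 2)) ^ 2 := by
    rw [← Real.rpow_mul_natCast (abs_nonneg x)]
    congr 1
    push_cast
    ring
  have h2 : Real.sqrt q ^ 2 = q := Real.sq_sqrt (by linarith)
  have h3 : q + 1 ≠ 0 := by linarith
  have h4 : 2 * Real.sqrt q / (q + 1) * ((q - 1) / 2 + 1) = Real.sqrt q := by
    field_simp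
    ring
  rw [h1]
  linear_combination (-2 * t * |x| ^ ((q - 1) / 2)) * h4 - (|x| ^ ((q - 1) / 2)) ^ 2 * h2

theorem sq_phiPM_sub_le {q : ℝ} (hq : 1 < q) (a b : ℝ) :
    (phiPM q a - phiPM q b) ^ 2 ≤ (psiPM q a - psiPM q b) * (a - b) := by
  wlog hab : b ≤ a generalizing a b
  · linarith [this b a (le_of_not_ge hab)]
  rcases hab.eq_or_lt with rfl | hlt
  · simp
  have hd : 0 < a - b := sub_pos.mpr hlt
  have h := monotone_psiPM_sub_phiPM_add hq ((phiPM q a - phiPM q b) / (a - b)) hab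
  simp only at h
  have ht : (phiPM q a - phiPM q b) / (a - b) * (a - b) = phiPM q a - phiPM q b :=
    div_mul_cancel₀ _ hd.ne'
  set t := (phiPM q a - phiPM q b) / (a - b)
  have h' : 0 ≤ (psiPM q a - psiPM q b) - 2 * t * (phiPM q a - phiPM q b) + t ^ 2 * (a - b) := by
    linarith
  have h'' := mul_nonneg h' hd.le
  rw [← ht] at h'' ⊢
  linarith

theorem sum_sum_neighbor_comm {ι : Type*} [Fintype ι] {N : ι → Finset ι}
    (hN : ∀ K L, L ∈ N K ↔ K ∈ N L) (F : ι → ι → ℝ) :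
    ∑ K, ∑ L ∈ N K, F K L = ∑ K, ∑ L ∈ N K, F L K :=
  Finset.sum_comm' fun K L => by simp [hN K L]

/-- Discrete integration by parts. -/
theorem sum_mul_sum_neighbor_sub {ι : Type*} [Fintype ι] {N : ι → Finset ι}
    (hN : ∀ K L, L ∈ N K ↔ K ∈ N L) {τ : ι → ι → ℝ} (hτ : ∀ K L, τ K L = τ L K)
    (u v : ι → ℝ) :
    ∑ K, u K * ∑ L ∈ N K, τ K L * (v K - v L)
      = (1/2) * ∑ K, ∑ L ∈ N K, τ K L * ((v K - v L) * (u K - u L)) := by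
  have h1 : ∑ K, u K * ∑ L ∈ N K, τ K L * (v K - v L)
      = ∑ K, ∑ L ∈ N K, u K * (τ K L * (v K - v L)) := by
    simp only [Finset.mul_sum]
  have h2 := sum_sum_neighbor_comm hN fun K L => u K * (τ K L * (v K - v L))
  have h3 : ∑ K, ∑ L ∈ N K, τ K L * ((v K - v L) * (u K - u L))
      = ∑ K, ∑ L ∈ N K, u K * (τ K L * (v K - v L))
        + ∑ K, ∑ L ∈ N K, u L * (τ L K * (v L - v K)) := by
    simp only [← Finset.sum_add_distrib]
    refine Finset.sum_congr rfl fun K _ => Finset.sum_congr rfl fun L _ => ?_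
    rw [hτ L K]
    ring
  rw [h1, h3, ← h2]
  ring

/-- Energy estimate for the implicit Euler step of the two-point flux finite volume
scheme for the porous medium equation.  Sums over edges `{K,L}` (each unordered pair
counted once) are written as half of the corresponding symmetric double sums. -/
theorem euler_step_energy_estimate
    (ι : Type*) [Fintype ι] [Nonempty ι]
    (mK : ι → ℝ) (hm : ∀ K, 0 < mK K)
    (N : ι → Finset ι) (hNsym : ∀ K L, L ∈ N K ↔ K ∈ N L) (hNirr : ∀ K, K ∉ N K)
    (τ : ι → ι → ℝ) (hτsym : ∀ K L, τ K L = τ L K) (hτpos : ∀ K L, L ∈ N K → 0 ≤ τ K L)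
    (q : ℝ) (hq : 1 < q) (Δt : ℝ) (hΔt : 0 < Δt)
    (u0 u1 : ι → ℝ)
    (hscheme : ∀ K, (u1 K - u0 K) * mK K / Δt
        + ∑ L ∈ N K, τ K L * (psiPM q (u1 K) - psiPM q (u1 L)) = 0) :
    (1/2) * ∑ K, mK K * (u1 K)^2
      + Δt * ((1/2) * ∑ K, ∑ L ∈ N K, τ K L * (phiPM q (u1 K) - phiPM q (u1 L))^2)
    ≤ (1/2) * ∑ K, mK K * (u0 K)^2 := by
  have hparts := sum_mul_sum_neighbor_sub hNsym hτsym u1 fun K => psiPM q (u1 K)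
  have hdiss : ∑ K, ∑ L ∈ N K, τ K L * (phiPM q (u1 K) - phiPM q (u1 L)) ^ 2
      ≤ ∑ K, ∑ L ∈ N K, τ K L * ((psiPM q (u1 K) - psiPM q (u1 L)) * (u1 K - u1 L)) :=
    Finset.sum_le_sum fun K _ => Finset.sum_le_sum fun L hL =>
      mul_le_mul_of_nonneg_left (sq_phiPM_sub_le hq _ _) (hτpos K L hL)
  have htime : ∑ K, (1/2) * (mK K * (u1 K) ^ 2)
      + ∑ K, Δt * (u1 K * ∑ L ∈ N K, τ K L * (psiPM q (u1 K) - psiPM q (u1 L)))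
      ≤ ∑ K, (1/2) * (mK K * (u0 K) ^ 2) := by
    rw [← Finset.sum_add_distrib]
    refine Finset.sum_le_sum fun K _ => ?_
    have hK : (u1 K - u0 K) * mK K
        + Δt * ∑ L ∈ N K, τ K L * (psiPM q (u1 K) - psiPM q (u1 L)) = 0 := by
      have h := hscheme K
      field_simp at h
      linarith
    have hsq := mul_nonneg (hm K).le (sq_nonneg (u1 K - u0 K))
    linear_combination u1 K * hK + (1/2) * hsq
  simp only [← Finset.mul_sum] at htime
  rw [hparts] at htime
  have := mul_le_mul_of_nonneg_left hdiss hΔt.le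
  linarith
end
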